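/- The diagonal subalgebra 𝔇 is a maximal abelian subalgebra of 𝔦: 𝔇 is commutative, and every T ∈ 𝔦 that commutes with every element of 𝔇 (T D = D T for all D ∈ 𝔇) belongs to 𝔇. -/

import Mathlib

noncomputable section

open ContinuousLinearMap
open scoped InnerProductSpace ComplexOrder

/-- The discrete monotone Fock space: `ℓ²` over the finite subsets of `ℤ`. -/
abbrev MF : Type := lp (fun _ : Finset ℤ => ℂ) 2

/-- The canonical orthonormal basis vector corresponding to a finite subset `S ⊆ ℤ`;
`eS ∅` is the vacuum vector `Ω`. -/
noncomputable def eS (S : Finset ℤ) : MF := lp.single 2 S 1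

/-- `a : ℤ → MF →L[ℂ] MF` is the family of monotone annihilation operators:
`a i (eS S) = eS (S \ {i})` if `S` is nonempty with `min S = i`, and `a i (eS S) = 0`
otherwise.  The creation operator `a_i†` is the Hilbert-space adjoint of `a i`. -/
def IsMonotoneAnnihilation (a : ℤ → MF →L[ℂ] MF) : Prop :=
  ∀ (i : ℤ) (S : Finset ℤ),
    (S.min = (i : WithBot ℤ) → a i (eS S) = eS (S.erase i)) ∧
    (S.min ≠ (i : WithBot ℤ) → a i (eS S) = 0)

/-- The monotone C*-algebra `𝔐`: the unital C*-subalgebra of `B(F)` generated by the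
annihilation operators. -/
noncomputable def MonM (a : ℤ → MF →L[ℂ] MF) : StarSubalgebra ℂ (MF →L[ℂ] MF) :=
  (StarAlgebra.adjoin ℂ (Set.range a)).topologicalClosure

/-- The non-unital monotone C*-algebra `𝔦`: the norm-closed star-subalgebra of `B(F)`
generated by the annihilation operators. -/
noncomputable def MonI (a : ℤ → MF →L[ℂ] MF) : NonUnitalStarSubalgebra ℂ (MF →L[ℂ] MF) :=
  (NonUnitalStarAlgebra.adjoin ℂ (Set.range a)).topologicalClosure

/-- The diagonal subalgebra `𝔇`: the elements of `𝔦` that are diagonal with respect to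
the canonical orthonormal basis of the monotone Fock space. -/
def MonDiag (a : ℤ → MF →L[ℂ] MF) : Set (MF →L[ℂ] MF) :=
  {T | T ∈ MonI a ∧ ∀ S S' : Finset ℤ, S ≠ S' → ⟪eS S, T (eS S')⟫_ℂ = 0}

lemma inner_eS_left (S : Finset ℤ) (x : MF) : ⟪eS S, x⟫_ℂ = x S := by
  simp [eS, lp.inner_single_left]

lemma inner_eS_eS (S U : Finset ℤ) : ⟪eS S, eS U⟫_ℂ = if S = U then 1 else 0 := by
  rw [inner_eS_left, eS]
  by_cases h : S = U
  · subst h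
    simp
  · rw [if_neg h, lp.single_apply_ne _ _ _ h]

lemma ext_inner_eS {x y : MF} (h : ∀ S, ⟪eS S, x⟫_ℂ = ⟪eS S, y⟫_ℂ) : x = y := by
  ext S
  simpa only [inner_eS_left] using h S

lemma ext_apply_eS {T D : MF →L[ℂ] MF} (h : ∀ S, T (eS S) = D (eS S)) : T = D := by
  refine lp.ext_continuousLinearMap (by norm_num) fun S => ?_
  ext1
  simpa [eS] using h S

/-- A diagonal operator acts on each basis vector as a scalar. -/
lemma exists_apply_eS_eq_smul {T : MF →L[ℂ] MF}
    (hT : ∀ S S' : Finset ℤ, S ≠ S' → ⟪eS S, T (eS S')⟫_ℂ = 0) (S : Finset ℤ) :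
    ∃ c : ℂ, T (eS S) = c • eS S := by
  refine ⟨⟪eS S, T (eS S)⟫_ℂ, ext_inner_eS fun U => ?_⟩
  rw [inner_smul_right, inner_eS_eS]
  by_cases h : U = S
  · subst h
    simp
  · simp [h, hT U S h]

lemma min_eq_coe_iff (S : Finset ℤ) (i : ℤ) :
    S.min = (i : WithBot ℤ) ↔ i ∈ S ∧ ∀ x ∈ S, i ≤ x := by
  change S.min = (i : WithTop ℤ) ↔ _
  constructor
  · intro h
    exact ⟨Finset.mem_of_min h, fun x hx => Finset.min_le_of_eq hx h⟩
  · rintro ⟨h, h'⟩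
    exact le_antisymm (Finset.min_le h) (Finset.le_min fun x hx => WithTop.coe_le_coe.2 (h' x hx))

lemma IsMonotoneAnnihilation.adjoint_apply_eS_erase {a : ℤ → MF →L[ℂ] MF}
    (ha : IsMonotoneAnnihilation a) {i : ℤ} {S : Finset ℤ} (hS : S.min = (i : WithBot ℤ)) :
    adjoint (a i) (eS (S.erase i)) = eS S := by
  refine ext_inner_eS fun U => ?_
  rw [adjoint_inner_right, inner_eS_eS]
  have hi := ((min_eq_coe_iff S i).1 hS).1
  by_cases hU : U.min = (i : WithBot ℤ)
  · have hi' := ((min_eq_coe_iff U i).1 hU).1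
    rw [(ha i U).1 hU, inner_eS_eS]
    congr 1
    refine propext ⟨fun h => ?_, fun h => h ▸ rfl⟩
    rw [← Finset.insert_erase hi, ← Finset.insert_erase hi', h]
  · have hne : U ≠ S := fun h => hU (h ▸ hS)
    rw [(ha i U).2 hU, inner_zero_left, if_neg hne]

lemma mem_MonI (a : ℤ → MF →L[ℂ] MF) (i : ℤ) : a i ∈ MonI a :=
  NonUnitalStarSubalgebra.le_topologicalClosure _
    (NonUnitalStarAlgebra.subset_adjoin ℂ _ ⟨i, rfl⟩)

lemma adjoint_mem_MonI (a : ℤ → MF →L[ℂ] MF) (i : ℤ) : adjoint (a i) ∈ MonI a :=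
  star_mem (mem_MonI a i)

lemma mem_MonDiag_of_apply_eS {a : ℤ → MF →L[ℂ] MF} {T : MF →L[ℂ] MF} (hT : T ∈ MonI a)
    (h : ∀ S, ∃ c : ℂ, T (eS S) = c • eS S) : T ∈ MonDiag a := by
  refine ⟨hT, fun S S' hne => ?_⟩
  obtain ⟨c, hc⟩ := h S'
  rw [hc, inner_smul_right, inner_eS_eS, if_neg hne, mul_zero]

/-- The operator `a_{i₁}† ⋯ a_{i_k}† a_{i_k} ⋯ a_{i₁}` attached to `S = {i₁ < ⋯ < i_k}` is a
diagonal element fixing `eS S` and killing every other basis vector of at most `k` particles. -/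
lemma IsMonotoneAnnihilation.exists_separating {a : ℤ → MF →L[ℂ] MF}
    (ha : IsMonotoneAnnihilation a) (S : Finset ℤ) (hS : S.Nonempty) :
    ∃ D ∈ MonDiag a, D (eS S) = eS S ∧
      ∀ U : Finset ℤ, U.card ≤ S.card → U ≠ S → D (eS U) = 0 := by
  suffices h : ∃ D ∈ MonI a, (∀ U, ∃ c : ℂ, D (eS U) = c • eS U) ∧ D (eS S) = eS S ∧
      ∀ U : Finset ℤ, U.card ≤ S.card → U ≠ S → D (eS U) = 0 by
    obtain ⟨D, hD, hc, h⟩ := h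
    exact ⟨D, mem_MonDiag_of_apply_eS hD hc, h⟩
  induction S using Finset.induction_on_min with
  | empty => exact absurd hS Finset.not_nonempty_empty
  | insert i S hi ih =>
    have hiS : i ∉ S := fun h => lt_irrefl _ (hi i h)
    have hmin : (insert i S).min = (i : WithBot ℤ) := by
      rw [min_eq_coe_iff]
      refine ⟨Finset.mem_insert_self _ _, fun x hx => ?_⟩
      rcases Finset.mem_insert.1 hx with rfl | hx
      · exact le_rfl
      · exact (hi x hx).le
    have hadj : adjoint (a i) (eS S) = eS (insert i S) := by
      simpa [Finset.erase_insert hiS] using ha.adjoint_apply_eS_erase hmin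
    have haS : a i (eS (insert i S)) = eS S := by
      simpa [Finset.erase_insert hiS] using (ha i _).1 hmin
    rcases S.eq_empty_or_nonempty with rfl | hne
    · refine ⟨adjoint (a i) * a i, mul_mem (adjoint_mem_MonI a i) (mem_MonI a i), fun U => ?_,
        ?_, fun U hU hUS => ?_⟩
      · by_cases hU : U.min = (i : WithBot ℤ)
        · refine ⟨1, ?_⟩
          rw [mul_apply_eq_comp, (ha i U).1 hU, ha.adjoint_apply_eS_erase hU, one_smul]
        · refine ⟨0, ?_⟩
          rw [mul_apply_eq_comp, (ha i U).2 hU, map_zero, zero_smul]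
      · rw [mul_apply_eq_comp, haS, hadj]
      · have hU' : U.min ≠ (i : WithBot ℤ) := by
          intro h
          have h1 := ((min_eq_coe_iff U i).1 h).1
          refine hUS (Finset.eq_of_subset_of_card_le ?_ hU).symm
          simpa using h1
        rw [mul_apply_eq_comp, (ha i U).2 hU', map_zero]
    · obtain ⟨D, hD, hc, hDS, hDU⟩ := ih hne
      refine ⟨adjoint (a i) * (D * a i),
        mul_mem (adjoint_mem_MonI a i) (mul_mem hD (mem_MonI a i)), fun U => ?_,
        ?_, fun U hU hUS => ?_⟩
      · by_cases hU : U.min = (i : WithBot ℤ)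
        · obtain ⟨c, hc⟩ := hc (U.erase i)
          refine ⟨c, ?_⟩
          rw [mul_apply_eq_comp, mul_apply_eq_comp, (ha i U).1 hU, hc, map_smul,
            ha.adjoint_apply_eS_erase hU]
        · refine ⟨0, ?_⟩
          rw [mul_apply_eq_comp, mul_apply_eq_comp, (ha i U).2 hU, map_zero, map_zero, zero_smul]
      · rw [mul_apply_eq_comp, mul_apply_eq_comp, haS, hDS, hadj]
      · rw [mul_apply_eq_comp, mul_apply_eq_comp]
        by_cases hU' : U.min = (i : WithBot ℤ)
        · have h1 := ((min_eq_coe_iff U i).1 hU').1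
          rw [(ha i U).1 hU', hDU, map_zero]
          · rw [Finset.card_erase_of_mem h1]
            rw [Finset.card_insert_of_notMem hiS] at hU
            omega
          · intro h
            exact hUS (by rw [← h, Finset.insert_erase h1])
        · rw [(ha i U).2 hU', map_zero, map_zero]

/-- The diagonal subalgebra `𝔇` is maximal abelian in `𝔦`: `𝔇` is commutative, and every
element of `𝔦` commuting with all of `𝔇` lies in `𝔇`. -/
theorem stmt19 (a : ℤ → MF →L[ℂ] MF) (ha : IsMonotoneAnnihilation a) :
    (∀ T ∈ MonDiag a, ∀ D ∈ MonDiag a, T * D = D * T) ∧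
    (∀ T ∈ MonI a, (∀ D ∈ MonDiag a, T * D = D * T) → T ∈ MonDiag a) := by
  refine ⟨fun T hT D hD => ext_apply_eS fun S => ?_, fun T hT hcomm => ⟨hT, fun S S' hne => ?_⟩⟩
  · obtain ⟨c, hc⟩ := exists_apply_eS_eq_smul hT.2 S
    obtain ⟨d, hd⟩ := exists_apply_eS_eq_smul hD.2 S
    rw [mul_apply_eq_comp, mul_apply_eq_comp, hc, hd, map_smul, map_smul, hc, hd, smul_comm]
  · rcases le_total S'.card S.card with hcard | hcard
    · have hS : S.Nonempty := by
        rw [Finset.nonempty_iff_ne_empty]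
        rintro rfl
        exact hne (Finset.card_eq_zero.1 (by simpa using hcard)).symm
      obtain ⟨D, hD, hDS, hDU⟩ := ha.exists_separating S hS
      have h1 : D (T (eS S')) = 0 := by
        rw [← mul_apply_eq_comp, ← hcomm D hD, mul_apply_eq_comp, hDU S' hcard hne.symm, map_zero]
      have h2 : adjoint D (eS S) = eS S := by
        refine ext_inner_eS fun U => ?_
        rw [adjoint_inner_right]
        by_cases h : U = S
        · rw [h, hDS]
        · rw [← inner_conj_symm, hD.2 S U (Ne.symm h), map_zero, inner_eS_eS, if_neg h]
      rw [← h2, adjoint_inner_left, h1, inner_zero_right]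
    · have hS : S'.Nonempty := by
        rw [Finset.nonempty_iff_ne_empty]
        rintro rfl
        exact hne (Finset.card_eq_zero.1 (by simpa using hcard))
      obtain ⟨D, hD, hDS, hDU⟩ := ha.exists_separating S' hS
      have h1 : T (eS S') = D (T (eS S')) := by
        rw [← mul_apply_eq_comp, ← hcomm D hD, mul_apply_eq_comp, hDS]
      have h2 : adjoint D (eS S) = 0 := by
        refine ext_inner_eS fun U => ?_
        rw [adjoint_inner_right, inner_zero_right]
        by_cases h : U = S
        · rw [h, hDU S hcard hne, inner_zero_left]
        · rw [← inner_conj_symm, hD.2 S U (Ne.symm h), map_zero]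
      rw [h1, ← adjoint_inner_left, h2, inner_zero_left]
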